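/- Let k be a field of characteristic 2 and let n, r be integers with n ≥ 2 and 1 ≤ r ≤ n-1. Let R be the localization of the ring k[x,y,z]/(z² + x²·y + x·y^n + x·y^{n-r}·z) at the maximal ideal generated by the images of x, y, z (the rational double point of type D_{2n}^r). Then the R-module Der_k(R) of k-linear derivations of R is free, but there exist no k-linear derivation D of R and element f ∈ R such that D(f) is a unit. -/

import Mathlib

open MvPolynomial

noncomputable section

/-- Evaluation at the origin on `k[x,y,z]/(P)`, for `P` with zero constant term. -/
def rdpEval (k : Type*) [Field k] (P : MvPolynomial (Fin 3) k)
    (hP : constantCoeff P = 0) :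
    (MvPolynomial (Fin 3) k ⧸ Ideal.span {P}) →+* k :=
  Ideal.Quotient.lift (Ideal.span {P}) (constantCoeff : MvPolynomial (Fin 3) k →+* k)
    (by
      intro a ha
      rw [Ideal.mem_span_singleton] at ha
      obtain ⟨c, rfl⟩ := ha
      rw [map_mul, hP, zero_mul])

/-- The maximal ideal of `k[x,y,z]/(P)` generated by the images of `x, y, z`, realized
as the kernel of evaluation at the origin. -/
def rdpMaxIdeal (k : Type*) [Field k] (P : MvPolynomial (Fin 3) k)
    (hP : constantCoeff P = 0) : Ideal (MvPolynomial (Fin 3) k ⧸ Ideal.span {P}) :=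
  RingHom.ker (rdpEval k P hP)

instance rdpMaxIdeal_isPrime (k : Type*) [Field k] (P : MvPolynomial (Fin 3) k)
    (hP : constantCoeff P = 0) : (rdpMaxIdeal k P hP).IsPrime :=
  RingHom.ker_isPrime _

/-- The local ring of the singularity: the localization of `k[x,y,z]/(P)` at the maximal
ideal generated by the images of `x, y, z`. -/
def rdpLocal (k : Type*) [Field k] (P : MvPolynomial (Fin 3) k)
    (hP : constantCoeff P = 0) : Type _ :=
  Localization (rdpMaxIdeal k P hP).primeCompl

instance rdpLocalCommRing (k : Type*) [Field k] (P : MvPolynomial (Fin 3) k)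
    (hP : constantCoeff P = 0) : CommRing (rdpLocal k P hP) :=
  inferInstanceAs (CommRing (Localization _))

instance rdpLocalAlgebra (k : Type*) [Field k] (P : MvPolynomial (Fin 3) k)
    (hP : constantCoeff P = 0) : Algebra k (rdpLocal k P hP) :=
  inferInstanceAs (Algebra k (Localization _))

section abstractPart

/-- The ring-theoretic core: solving the tangency equation. -/
lemma tangency_solve {R : Type*} [CommRing R] (h2 : (2 : R) = 0) (x y z : R) (n m r : ℕ)
    (hm : 1 ≤ m) (hr : 1 ≤ r) (hn : n = m + r)
    (hrel : z ^ 2 + x ^ 2 * y + x * y ^ n + x * y ^ m * z = 0)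
    (hx : ∀ a, x * a = 0 → a = 0) (hy : ∀ a, y * a = 0 → a = 0)
    (hyx : ∀ b, y ∣ x * b → y ∣ b) (a b c : R)
    (h : a * (y ^ n + y ^ m * z) + b * (x * (x + (n * y ^ (n - 1) + m * y ^ (m - 1) * z)))
      + c * (x * y ^ m) = 0) :
    ∃ a' b', a = x * a' ∧ b = y ^ m * b' ∧
      c = a' * (y ^ r + z) + b' * (x + (n * y ^ (n - 1) + m * y ^ (m - 1) * z)) := by
  have hyc : ∀ (j : ℕ) a, y ^ j * a = 0 → a = 0 := by
    intro j
    induction j with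
    | zero => intro a ha; simpa using ha
    | succ j ih =>
      intro a ha
      exact hy _ (ih _ (by rw [← ha]; ring))
  have hyxm : ∀ (j : ℕ) b, y ^ j ∣ x * b → y ^ j ∣ b := by
    intro j
    induction j with
    | zero => intro b _; simp
    | succ j ih =>
      intro b hb
      obtain ⟨b1, rfl⟩ := hyx b ((dvd_pow_self y (by omega)).trans hb)
      obtain ⟨c, hc⟩ := hb
      have : x * b1 = y ^ j * c := by
        have := hy (x * b1 - y ^ j * c) (by linear_combination hc)
        linear_combination this
      have := ih b1 ⟨c, this⟩
      rw [pow_succ, mul_comm]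
      exact mul_dvd_mul dvd_rfl this
  have hxy : ∀ (j : ℕ) a, x ∣ y ^ j * a → x ∣ a := by
    intro j a ⟨c, hc⟩
    obtain ⟨d, rfl⟩ := hyxm j c ⟨a, hc.symm⟩
    refine ⟨d, ?_⟩
    have := hyc j (a - x * d) (by linear_combination hc)
    linear_combination this
  -- first step
  obtain ⟨m', rfl⟩ : ∃ m', m = m' + 1 := ⟨m - 1, by omega⟩
  obtain ⟨r', rfl⟩ : ∃ r', r = r' + 1 := ⟨r - 1, by omega⟩
  subst hn
  simp only [Nat.add_sub_cancel, show m' + 1 + (r' + 1) - 1 = m' + 1 + r' by omega] at *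
  set q : R := (((m' + 1 + (r' + 1) : ℕ) : R) * y ^ (m' + 1 + r') + ((m' + 1 : ℕ) : R) * y ^ m' * z)
    with hq
  set N : R := ((m' + 1 + (r' + 1) : ℕ) : R)
  set M : R := ((m' + 1 : ℕ) : R)
  have hq2 : y ^ (m' + 1) ∣ q ^ 2 := by
    refine ⟨N ^ 2 * y ^ (m' + 1 + 2 * r') + 2 * N * M * y ^ (m' + r') * z
      - M ^ 2 * (y ^ m' * x ^ 2 + x * y ^ (2 * m' + 1 + r')  + x * y ^ (2 * m') * z), ?_⟩
    rw [hq]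
    linear_combination M ^ 2 * y ^ (2 * m') * hrel
  have hb : y ^ (m' + 1) ∣ b := by
    apply hyxm; apply hyxm; apply hyxm
    obtain ⟨t, ht⟩ := hq2
    refine ⟨- (x + q) * (a * (y ^ (r' + 1) + z) + c * x) - x * b * t - b * x ^ 2 * 0, ?_⟩
    linear_combination (x + q) * h - x * b * ht - (b * x * x * q ) * h2
  obtain ⟨b', rfl⟩ := hb
  have h3 : a * (y ^ (r' + 1) + z) + b' * (x * (x + q)) + c * x = 0 := by
    apply hyc (m' + 1)
    linear_combination h
  have ha : x ∣ a := by
    apply hxy (2 * (r' + 1))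
    refine ⟨- (y ^ (r' + 1) + z) * (b' * (x + q) + c)
      + a * (x * y + y ^ (m' + 1 + (r' + 1)) + y ^ (m' + 1) * z), ?_⟩
    linear_combination (y ^ (r' + 1) + z) * h3 - a * hrel - a * y ^ (r' + 1) * z * h2
      + 0 * h2
  obtain ⟨a', rfl⟩ := ha
  refine ⟨a', b', rfl, rfl, ?_⟩
  have h4 : a' * (y ^ (r' + 1) + z) + b' * (x + q) + c = 0 := by
    apply hx
    linear_combination h3
  linear_combination -h4 + c * h2

variable {k : Type*} [Field k] {P : MvPolynomial (Fin 3) k}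
  {R : Type*} [CommRing R] [Algebra k R]

/-- `R` is the localization at the origin of `k[x,y,z]/(P)` via `i`. -/
structure IsOriginLoc (P : MvPolynomial (Fin 3) k) (i : MvPolynomial (Fin 3) k →ₐ[k] R) : Prop where
  unit : ∀ s, constantCoeff s ≠ 0 → IsUnit (i s)
  surj : ∀ f, ∃ a s, constantCoeff s ≠ 0 ∧ i s * f = i a
  zero : ∀ a, i a = 0 ↔ ∃ u, constantCoeff u ≠ 0 ∧ P ∣ u * a
  liftT : ∀ (φ : MvPolynomial (Fin 3) k →ₐ[k] TrivSqZeroExt R R), φ P = 0 →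
    (∀ s, constantCoeff s ≠ 0 → IsUnit (φ s)) →
    ∃ ψ : R →ₐ[k] TrivSqZeroExt R R, ∀ p, ψ (i p) = φ p
  ev : ∃ e : R →+* k, ∀ p, e (i p) = constantCoeff p

variable {i : MvPolynomial (Fin 3) k →ₐ[k] R}

lemma IsOriginLoc.exists_der (h : IsOriginLoc P i) (v : Fin 3 → R)
    (hv : ∑ j, v j * i (pderiv j P) = 0) :
    ∃ D : Derivation k R R, ∀ j, D (i (X j)) = v j := by
  let φ : MvPolynomial (Fin 3) k →ₐ[k] TrivSqZeroExt R R :=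
    aeval (fun j => TrivSqZeroExt.inl (i (X j)) + TrivSqZeroExt.inr (v j))
  have hφ : ∀ p, (φ p).fst = i p ∧ (φ p).snd = ∑ j, v j * i (pderiv j p) := by
    intro p
    induction p using MvPolynomial.induction_on with
    | C a =>
      have : φ (C a) = algebraMap k _ a := by simp [φ]
      rw [this]
      constructor
      · rw [← MvPolynomial.algebraMap_eq, AlgHom.commutes]; rfl
      · simp; rfl
    | add p q hp hq =>
      simp [hp.1, hp.2, hq.1, hq.2, mul_add, Finset.sum_add_distrib]
    | mul_X p j hp =>
      have : φ (X j) = TrivSqZeroExt.inl (i (X j)) + TrivSqZeroExt.inr (v j) := by simp [φ]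
      rw [map_mul, this]
      constructor
      · simp [hp.1]
      · simp only [TrivSqZeroExt.snd_mul, hp.1, hp.2]
        simp only [Fin.sum_univ_three, Derivation.leibniz, map_add, smul_eq_mul, map_mul]
        fin_cases j <;> simp [pderiv_X] <;> ring
  obtain ⟨ψ, hψ⟩ := h.liftT φ (by
      ext
      · rw [(hφ P).1]; simpa using (h.zero P).2 ⟨1, by simp, by simp⟩
      · rw [(hφ P).2, hv]; rfl) (by
      intro s hs
      rw [TrivSqZeroExt.isUnit_iff_isUnit_fst, (hφ s).1]
      exact h.unit s hs)
  have hfst : ∀ f, (ψ f).fst = f := by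
    intro f
    obtain ⟨a, s, hs, hf⟩ := h.surj f
    apply (h.unit s hs).mul_left_cancel
    have := congrArg (fun t => (ψ t).fst) hf
    simp only [map_mul, hψ, TrivSqZeroExt.fst_mul, (hφ _).1] at this
    rw [this, hf]
  refine ⟨Derivation.mk'
    { toFun := fun f => (ψ f).snd
      map_add' := by intro a b; simp
      map_smul' := by intro a b; simp } ?_, ?_⟩
  · intro a b
    simp [hfst, mul_comm]
  · intro j
    change (ψ (i (X j))).snd = _
    rw [hψ]
    simp [φ]

lemma IsOriginLoc.der_poly (D : Derivation k R R) (p : MvPolynomial (Fin 3) k) :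
    D (i p) = ∑ j, D (i (X j)) * i (pderiv j p) := by
  induction p using MvPolynomial.induction_on with
  | C a =>
    rw [← MvPolynomial.algebraMap_eq, AlgHom.commutes, Derivation.map_algebraMap]
    simp
  | add p q hp hq => simp [hp, hq, mul_add, Finset.sum_add_distrib]
  | mul_X p j hp =>
    simp only [map_mul, Derivation.leibniz, hp, smul_eq_mul]
    simp only [Fin.sum_univ_three, map_add, map_mul]
    fin_cases j <;> simp [pderiv_X] <;> ring

lemma IsOriginLoc.der_mem (h : IsOriginLoc P i) (I : Ideal R) (D : Derivation k R R)
    (hD : ∀ j, D (i (X j)) ∈ I) (f : R) : D f ∈ I := by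
  have hp : ∀ p, D (i p) ∈ I := by
    intro p
    rw [IsOriginLoc.der_poly]
    exact Ideal.sum_mem _ fun j _ => I.mul_mem_right _ (hD j)
  obtain ⟨a, s, hs, hf⟩ := h.surj f
  have h1 := congrArg D hf
  rw [Derivation.leibniz, smul_eq_mul, smul_eq_mul] at h1
  have h2 : i s * D f ∈ I := by
    have : i s * D f = D (i a) - f * D (i s) := by linear_combination h1
    rw [this]
    exact I.sub_mem (hp _) (I.mul_mem_left _ (hp _))
  exact (Ideal.unit_mul_mem_iff_mem I (h.unit s hs)).1 h2

lemma IsOriginLoc.der_ext (h : IsOriginLoc P i) (D D' : Derivation k R R)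
    (hD : ∀ j, D (i (X j)) = D' (i (X j))) : D = D' := by
  ext f
  have := h.der_mem ⊥ (D - D') (by intro j; simp [hD j]) f
  rw [Ideal.mem_bot, Derivation.sub_apply] at this
  exact sub_eq_zero.1 this

end abstractPart

section polyPart

variable {k : Type*} [Field k]

/-- The equation of `D_{2n}^r`, with `m = n - r`. -/
abbrev eqD (k : Type*) [Field k] (n m : ℕ) : MvPolynomial (Fin 3) k :=
  X 2 ^ 2 + X 0 ^ 2 * X 1 + X 0 * X 1 ^ n + X 0 * X 1 ^ m * X 2

lemma X_dvd_of_not_dvd (j : Fin 3) (p q : MvPolynomial (Fin 3) k) (hp : ¬ X j ∣ p)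
    (h : X j ∣ p * q) : X j ∣ q :=
  (X_dvd_mul_iff.1 h).resolve_left hp

lemma X0_not_dvd (n m : ℕ) : ¬ (X 0 : MvPolynomial (Fin 3) k) ∣ eqD k n m := by
  rintro ⟨c, hc⟩
  have := congrArg (eval ![0, 0, 1]) hc
  simp at this

lemma X1_not_dvd (n m : ℕ) :
    ¬ (X 1 : MvPolynomial (Fin 3) k) ∣ eqD k n m := by
  rintro ⟨c, hc⟩
  have := congrArg (eval ![0, 0, 1]) hc
  simp at this

lemma X_nzd (j : Fin 3) (P b : MvPolynomial (Fin 3) k) (hP : ¬ X j ∣ P) (h : P ∣ X j * b) :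
    P ∣ b := by
  obtain ⟨c, hc⟩ := h
  obtain ⟨d, rfl⟩ := X_dvd_of_not_dvd j P c hP ⟨b, hc.symm⟩
  refine ⟨d, ?_⟩
  apply mul_left_cancel₀ (X_ne_zero j)
  rw [hc]; ring

lemma reg_poly (n m : ℕ) (hn : n ≠ 0) (hm : m ≠ 0) (b c : MvPolynomial (Fin 3) k)
    (h : eqD k n m ∣ X 0 * b - X 1 * c) : ∃ d, eqD k n m ∣ b - X 1 * d := by
  obtain ⟨e, he⟩ := h
  let φ : MvPolynomial (Fin 3) k →ₐ[k] MvPolynomial (Fin 3) k := aeval ![X 0, 0, X 2]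
  have hφ : ∀ p, X 1 ∣ p - φ p := by
    intro p
    induction p using MvPolynomial.induction_on with
    | C a => simp [φ]
    | add p q hp hq =>
      rw [map_add, add_sub_add_comm]; exact dvd_add hp hq
    | mul_X p j hp =>
      have h1 : X 1 ∣ (X j : MvPolynomial (Fin 3) k) - φ (X j) := by
        fin_cases j <;> simp [φ]
      have : p * X j - φ (p * X j) = (p - φ p) * X j + φ p * (X j - φ (X j)) := by
        rw [map_mul]; ring
      rw [this]
      exact dvd_add (hp.mul_right _) (h1.mul_left _)
  have h1 : X 0 * φ b = X 2 ^ 2 * φ e := by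
    have := congrArg φ he
    simpa [φ, hn, hm] using this
  have h2 : ¬ (X 0 : MvPolynomial (Fin 3) k) ∣ X 2 ^ 2 := by
    rintro ⟨c, hc⟩
    have := congrArg (eval ![0, 0, 1]) hc
    simp at this
  obtain ⟨d, hd⟩ := X_dvd_of_not_dvd 0 _ _ h2 ⟨_, h1.symm⟩
  have h3 : φ b = X 2 ^ 2 * d := by
    apply mul_left_cancel₀ (X_ne_zero (0 : Fin 3))
    rw [h1, hd]; ring
  obtain ⟨t, ht⟩ := hφ b
  obtain ⟨n', rfl⟩ : ∃ n', n = n' + 1 := ⟨n - 1, by omega⟩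
  obtain ⟨m', rfl⟩ : ∃ m', m = m' + 1 := ⟨m - 1, by omega⟩
  refine ⟨t - d * (X 0 ^ 2 + X 0 * X 1 ^ n' + X 0 * X 1 ^ m' * X 2), d, ?_⟩
  rw [h3] at ht
  linear_combination ht

end polyPart
section final
variable {k : Type*} [Field k] {R : Type*} [CommRing R] [Algebra k R]

lemma final_abstract [CharP k 2] (n m r : ℕ) (hm : 1 ≤ m) (hr : 1 ≤ r) (hn : n = m + r)
    (i : MvPolynomial (Fin 3) k →ₐ[k] R) (h : IsOriginLoc (eqD k n m) i) :
    Module.Free R (Derivation k R R) ∧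
      ¬ ∃ (D : Derivation k R R) (f : R), IsUnit (D f) := by
  have h2 : (2 : R) = 0 := by
    have : algebraMap k R 2 = 0 := by rw [CharTwo.two_eq_zero, map_zero]
    rwa [map_ofNat] at this
  have h2' : (2 : MvPolynomial (Fin 3) k) = 0 := CharTwo.two_eq_zero
  set x := i (X 0) with hx
  set y := i (X 1) with hy
  set z := i (X 2) with hz
  have hP : i (eqD k n m) = 0 := (h.zero _).2 ⟨1, by simp, by simp⟩
  have hrel : z ^ 2 + x ^ 2 * y + x * y ^ n + x * y ^ m * z = 0 := by
    simpa [eqD] using hP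
  have nzd : ∀ j : Fin 3, ¬ X j ∣ eqD k n m → ∀ a, i (X j) * a = 0 → a = 0 := by
    intro j hj a ha
    obtain ⟨p, s, hs, hf⟩ := h.surj a
    have : i (X j * p) = 0 := by
      rw [map_mul, ← hf]; linear_combination i s * ha
    obtain ⟨u, hu, hd⟩ := (h.zero _).1 this
    have : i p = 0 := (h.zero _).2 ⟨u, hu, X_nzd j _ _ hj (by
      rw [show X j * (u * p) = u * (X j * p) by ring]; exact hd)⟩
    apply (h.unit s hs).mul_left_cancel
    rw [hf, this, mul_zero]
  have hyx : ∀ b, y ∣ x * b → y ∣ b := by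
    rintro b ⟨c, hc⟩
    obtain ⟨p, s, hs, hf⟩ := h.surj b
    obtain ⟨q, t, ht, hg⟩ := h.surj c
    have : i (X 0 * (t * p) - X 1 * (s * q)) = 0 := by
      simp only [map_sub, map_mul, ← hf, ← hg, ← hx, ← hy]
      linear_combination i s * i t * hc
    obtain ⟨u, hu, hd⟩ := (h.zero _).1 this
    obtain ⟨d, hd'⟩ := reg_poly n m (by omega) (by omega) (u * (t * p)) (u * (s * q)) (by
      convert hd using 1; ring)
    have h5 : i (u * (t * p) - X 1 * d) = 0 := (h.zero _).2 ⟨1, by simp, by simpa using hd'⟩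
    have h6 : y ∣ i (u * t * s) * b := by
      refine ⟨i d, ?_⟩
      simp only [map_sub, map_mul, ← hf, ← hy] at h5 ⊢
      linear_combination h5
    have hu' : IsUnit (i (u * t * s)) := h.unit _ (by simp [hu, ht, hs])
    exact (hu'.dvd_mul_left).1 h6
  have hxz := nzd 0 (X0_not_dvd n m)
  have hyz := nzd 1 (X1_not_dvd n m)
  have hPx : i (pderiv 0 (eqD k n m)) = y ^ n + y ^ m * z := by
    simp [eqD, pderiv_X, ← hx, ← hy, ← hz]
    rw [h2', map_zero]; ring
  have hPy : i (pderiv 1 (eqD k n m)) =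
      x * (x + (n * y ^ (n - 1) + m * y ^ (m - 1) * z)) := by
    simp [eqD, pderiv_X, ← hx, ← hy, ← hz]
    ring
  have hPz : i (pderiv 2 (eqD k n m)) = x * y ^ m := by
    simp [eqD, pderiv_X, ← hx, ← hy, ← hz]
    rw [h2', map_zero]; ring
  have key : ∀ D : Derivation k R R, ∃ a' b', D x = x * a' ∧ D y = y ^ m * b' ∧
      D z = a' * (y ^ r + z) + b' * (x + (n * y ^ (n - 1) + m * y ^ (m - 1) * z)) := by
    intro D
    apply tangency_solve h2 x y z n m r hm hr hn hrel hxz hyz hyx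
    have := IsOriginLoc.der_poly (i := i) D (eqD k n m)
    rw [hP, map_zero, Fin.sum_univ_three, hPx, hPy, hPz] at this
    exact this.symm
  obtain ⟨D1, hD1⟩ := h.exists_der ![x, 0, y ^ r + z] (by
    rw [Fin.sum_univ_three, hPx, hPy, hPz]
    simp
    rw [hn]
    linear_combination x * (y ^ (m + r) + y ^ m * z) * h2)
  obtain ⟨D2, hD2⟩ := h.exists_der
    ![0, y ^ m, x + (n * y ^ (n - 1) + m * y ^ (m - 1) * z)] (by
    rw [Fin.sum_univ_three, hPx, hPy, hPz]
    simp
    linear_combination y ^ m * (x * (x + (n * y ^ (n - 1) + m * y ^ (m - 1) * z))) * h2)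
  have h10 : D1 x = x := hD1 0
  have h11 : D1 y = 0 := hD1 1
  have h12 : D1 z = y ^ r + z := hD1 2
  have h20 : D2 x = 0 := hD2 0
  have h21 : D2 y = y ^ m := hD2 1
  have h22 : D2 z = x + (n * y ^ (n - 1) + m * y ^ (m - 1) * z) := hD2 2
  constructor
  · let F : (R × R) →ₗ[R] Derivation k R R :=
      (LinearMap.toSpanSingleton R _ D1).coprod (LinearMap.toSpanSingleton R _ D2)
    have hF : ∀ a b f, F (a, b) f = a * D1 f + b * D2 f := by
      intro a b f; simp [F]
    have hbij : Function.Bijective F := by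
      constructor
      · rw [← LinearMap.ker_eq_bot, LinearMap.ker_eq_bot']
        rintro ⟨a, b⟩ hab
        have e1 := hF a b x
        have e2 := hF a b y
        rw [hab, h10, h20, Derivation.zero_apply] at e1
        rw [hab, h11, h21, Derivation.zero_apply] at e2
        have ha : a = 0 := hxz a (by linear_combination -e1)
        have hyc : ∀ (j : ℕ) a, y ^ j * a = 0 → a = 0 := by
          intro j
          induction j with
          | zero => intro a ha; simpa using ha
          | succ j ih =>
            intro a ha
            exact hyz _ (ih _ (by rw [← ha]; ring))
        have hb : b = 0 := hyc m b (by linear_combination -e2)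
        rw [ha, hb]; rfl
      · intro D
        obtain ⟨a, b, e0, e1, e2⟩ := key D
        refine ⟨(a, b), h.der_ext _ _ ?_⟩
        intro j
        rw [hF]
        fin_cases j
        · change a * D1 x + b * D2 x = D x
          rw [h10, h20, e0]; ring
        · change a * D1 y + b * D2 y = D y
          rw [h11, h21, e1]; ring
        · change a * D1 z + b * D2 z = D z
          rw [h12, h22, e2]
    exact Module.Free.of_equiv (LinearEquiv.ofBijective F hbij)
  · rintro ⟨D, f, hDf⟩
    obtain ⟨e, he⟩ := h.ev
    have ex : e x = 0 := by rw [hx, he]; simp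
    have ey : e y = 0 := by rw [hy, he]; simp
    have ez : e z = 0 := by rw [hz, he]; simp
    obtain ⟨a, b, e0, e1, e2⟩ := key D
    have hmem : D f ∈ RingHom.ker e := by
      apply h.der_mem
      intro j
      rw [RingHom.mem_ker]
      fin_cases j
      · change e (D x) = 0
        rw [e0]; simp [ex]
      · change e (D y) = 0
        rw [e1]; simp [ey, show m ≠ 0 by omega]
      · change e (D z) = 0
        rw [e2]; simp [ex, ey, ez, show r ≠ 0 by omega, show n - 1 ≠ 0 by omega]
    rw [RingHom.mem_ker] at hmem
    have := hDf.map e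
    rw [hmem] at this
    exact not_isUnit_zero this

end final

section localization

/-- The canonical map from the polynomial ring. -/
def locMap (k : Type*) [Field k] (P : MvPolynomial (Fin 3) k) (R : Type*) [CommRing R] [Algebra k R]
    [Algebra (MvPolynomial (Fin 3) k ⧸ Ideal.span {P}) R]
    [IsScalarTower k (MvPolynomial (Fin 3) k ⧸ Ideal.span {P}) R] :
    MvPolynomial (Fin 3) k →ₐ[k] R :=
  (IsScalarTower.toAlgHom k (MvPolynomial (Fin 3) k ⧸ Ideal.span {P}) R).comp
    (Ideal.Quotient.mkₐ k (Ideal.span {P}))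

lemma mem_compl {k : Type*} [Field k] {P : MvPolynomial (Fin 3) k} (hP : constantCoeff P = 0)
    (s : MvPolynomial (Fin 3) k) :
    Ideal.Quotient.mk (Ideal.span {P}) s ∈ (rdpMaxIdeal k P hP).primeCompl ↔
      constantCoeff s ≠ 0 := by
  rw [Ideal.mem_primeCompl_iff, rdpMaxIdeal, RingHom.mem_ker, rdpEval, Ideal.Quotient.lift_mk]

lemma locMap_isOriginLoc (k : Type*) [Field k] (P : MvPolynomial (Fin 3) k)
    (hP : constantCoeff P = 0) (R : Type*) [CommRing R] [Algebra k R]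
    [Algebra (MvPolynomial (Fin 3) k ⧸ Ideal.span {P}) R]
    [IsScalarTower k (MvPolynomial (Fin 3) k ⧸ Ideal.span {P}) R]
    [IsLocalization (rdpMaxIdeal k P hP).primeCompl R] :
    IsOriginLoc P (locMap k P R) := by
  have hap : ∀ p, locMap k P R p = algebraMap _ _ (Ideal.Quotient.mk (Ideal.span {P}) p) :=
    fun p => rfl
  refine ⟨?_, ?_, ?_, ?_, ?_⟩
  · intro s hs
    rw [hap]
    exact IsLocalization.map_units _
      (⟨_, (mem_compl hP s).2 hs⟩ : (rdpMaxIdeal k P hP).primeCompl)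
  · intro f
    obtain ⟨⟨a, s⟩, hf⟩ := IsLocalization.surj (rdpMaxIdeal k P hP).primeCompl f
    obtain ⟨s, hs⟩ := s
    obtain ⟨a, rfl⟩ := Ideal.Quotient.mk_surjective a
    obtain ⟨s, rfl⟩ := Ideal.Quotient.mk_surjective s
    refine ⟨a, s, (mem_compl hP s).1 hs, ?_⟩
    rw [hap, hap, mul_comm]
    exact hf
  · intro a
    rw [hap, IsLocalization.map_eq_zero_iff (rdpMaxIdeal k P hP).primeCompl]
    constructor
    · rintro ⟨⟨u, hu⟩, h⟩
      obtain ⟨u, rfl⟩ := Ideal.Quotient.mk_surjective u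
      refine ⟨u, (mem_compl hP u).1 hu, ?_⟩
      rw [← map_mul, Ideal.Quotient.eq_zero_iff_mem, Ideal.mem_span_singleton] at h
      exact h
    · rintro ⟨u, hu, h⟩
      refine ⟨⟨_, (mem_compl hP u).2 hu⟩, ?_⟩
      rw [← map_mul, Ideal.Quotient.eq_zero_iff_mem, Ideal.mem_span_singleton]
      exact h
  · intro φ hφ hu
    let φ' := Ideal.Quotient.liftₐ (Ideal.span {P}) φ (by
      intro a ha
      rw [Ideal.mem_span_singleton] at ha
      obtain ⟨c, rfl⟩ := ha
      rw [map_mul, hφ, zero_mul])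
    have hφ' : ∀ p, φ' (Ideal.Quotient.mk _ p) = φ p := fun p => rfl
    have hf : ∀ s : (rdpMaxIdeal k P hP).primeCompl, IsUnit (φ' s) := by
      rintro ⟨s, hs⟩
      obtain ⟨s, rfl⟩ := Ideal.Quotient.mk_surjective s
      exact hu s ((mem_compl hP s).1 hs)
    refine ⟨IsLocalization.liftAlgHom (M := (rdpMaxIdeal k P hP).primeCompl) (f := φ') hf, ?_⟩
    intro p
    rw [hap, IsLocalization.liftAlgHom_apply]
    exact IsLocalization.lift_eq _ _
  · have hf : ∀ s : (rdpMaxIdeal k P hP).primeCompl, IsUnit (rdpEval k P hP s) := by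
      rintro ⟨s, hs⟩
      obtain ⟨s, rfl⟩ := Ideal.Quotient.mk_surjective s
      exact isUnit_iff_ne_zero.2 ((mem_compl hP s).1 hs)
    refine ⟨IsLocalization.lift (M := (rdpMaxIdeal k P hP).primeCompl) hf, ?_⟩
    intro p
    rw [hap, IsLocalization.lift_eq]
    rfl

end localization

lemma rdpLocal_exists (k : Type*) [Field k] (P : MvPolynomial (Fin 3) k)
    (hP : constantCoeff P = 0) :
    ∃ i : MvPolynomial (Fin 3) k →ₐ[k] rdpLocal k P hP, IsOriginLoc P i := by
  letI : Algebra (MvPolynomial (Fin 3) k ⧸ Ideal.span {P}) (rdpLocal k P hP) :=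
    inferInstanceAs (Algebra _ (Localization (rdpMaxIdeal k P hP).primeCompl))
  haveI : IsScalarTower k (MvPolynomial (Fin 3) k ⧸ Ideal.span {P}) (rdpLocal k P hP) :=
    inferInstanceAs (IsScalarTower k (MvPolynomial (Fin 3) k ⧸ Ideal.span {P})
      (Localization (rdpMaxIdeal k P hP).primeCompl))
  haveI : IsLocalization (rdpMaxIdeal k P hP).primeCompl (rdpLocal k P hP) :=
    inferInstanceAs (IsLocalization (rdpMaxIdeal k P hP).primeCompl
      (Localization (rdpMaxIdeal k P hP).primeCompl))
  exact ⟨locMap k P _, locMap_isOriginLoc k P hP _⟩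

/-- For the rational double point `R` of type `D_{2n}^r` in characteristic `2`, given by
`z² + x²y + x·yⁿ + x·y^{n-r}·z = 0` with `n ≥ 2` and `1 ≤ r ≤ n - 1`: the module
`Der_k(R)` of `k`-linear derivations is free, but no derivation takes a unit value. -/
theorem rdp_D2n_r_char_two (k : Type*) [Field k] [CharP k 2]
    (n r : ℕ) (hn : 2 ≤ n) (hr1 : 1 ≤ r) (hr : r ≤ n - 1) :
    let R := rdpLocal k
      (X 2 ^ 2 + X 0 ^ 2 * X 1 + X 0 * X 1 ^ n + X 0 * X 1 ^ (n - r) * X 2) (by simp)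
    Module.Free R (Derivation k R R) ∧
      ¬ ∃ (D : Derivation k R R) (f : R), IsUnit (D f) := by
  intro R
  obtain ⟨i, hi⟩ := rdpLocal_exists k (eqD k n (n - r)) (by simp)
  exact final_abstract n (n - r) r (by omega) hr1 (by omega) i hi
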